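/- arXiv:2111.15314 — 3 statements merged into one kernel-verified Lean document; each statement's English description precedes it below -/
import Mathlib

section
/- For every θ ≥ 0, every measurable essentially bounded function u on [0,θ], all nonnegative integers m, n and all finite lists M, N of nonnegative integers, the product of nonlinear power moments satisfies the recursion ξ_{m::M}(θ,u)·ξ_{n::N}(θ,u) = ∫_0^θ τ^m u(τ) ξ_M(τ,u) ξ_{n::N}(τ,u) dτ + ∫_0^θ τ^n u(τ) ξ_{m::M}(τ,u) ξ_N(τ,u) dτ. -/
open MeasureTheory

/-- Nonlinear power moments: `xi [] θ u = 1` and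
`xi (m :: M) θ u = ∫_0^θ τ^m u(τ) xi M τ u dτ`. -/
noncomputable def xi : List ℕ → ℝ → (ℝ → ℝ) → ℝ
  | [], _, _ => 1
  | m :: M, θ, u => ∫ τ in (0:ℝ)..θ, τ ^ m * u τ * xi M τ u

/-- The product of the primitives of two interval integrable functions is the sum of the integrals
given by the Leibniz rule. -/
theorem IntervalIntegrable.integral_mul_integral {f g : ℝ → ℝ} {a b : ℝ}
    (hf : IntervalIntegrable f volume a b) (hg : IntervalIntegrable g volume a b) :
    (∫ x in a..b, f x) * ∫ x in a..b, g x =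
      (∫ x in a..b, f x * ∫ t in a..x, g t) + ∫ x in a..b, (∫ t in a..x, f t) * g x := by
  have hF := hf.absolutelyContinuousOnInterval_intervalIntegral (c := a) Set.left_mem_uIcc
  have hG := hg.absolutelyContinuousOnInterval_intervalIntegral (c := a) Set.left_mem_uIcc
  have h := hF.integral_deriv_mul_eq_sub hG
  simp only [intervalIntegral.integral_same, mul_zero, sub_zero] at h
  rw [← h, ← intervalIntegral.integral_add (hf.mul_continuousOn hG.continuousOn)
    (hg.continuousOn_mul hF.continuousOn)]
  apply intervalIntegral.integral_congr_ae
  filter_upwards [hf.ae_hasDerivAt_integral, hg.ae_hasDerivAt_integral] with x hfx hgx hx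
  have hx' := Set.uIoc_subset_uIcc hx
  rw [(hfx hx' a Set.left_mem_uIcc).deriv, (hgx hx' a Set.left_mem_uIcc).deriv]

theorem continuousOn_xi {θ : ℝ} {u : ℝ → ℝ} (hu : IntervalIntegrable u volume 0 θ) (M : List ℕ) :
    ContinuousOn (fun τ ↦ xi M τ u) (Set.uIcc 0 θ) := by
  induction M with
  | nil => simpa only [xi] using continuousOn_const
  | cons m M ih =>
    have h := (hu.continuousOn_mul (continuous_pow m).continuousOn).mul_continuousOn ih
    simpa only [xi] using
      (h.absolutelyContinuousOnInterval_intervalIntegral Set.left_mem_uIcc).continuousOn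

theorem intervalIntegrable_pow_mul_mul_xi {θ : ℝ} {u : ℝ → ℝ}
    (hu : IntervalIntegrable u volume 0 θ) (m : ℕ) (M : List ℕ) :
    IntervalIntegrable (fun τ ↦ τ ^ m * u τ * xi M τ u) volume 0 θ :=
  (hu.continuousOn_mul (continuous_pow m).continuousOn).mul_continuousOn (continuousOn_xi hu M)

/-- The product of nonlinear power moments satisfies the recursion
`ξ_{m::M}(θ,u)·ξ_{n::N}(θ,u) = ∫_0^θ τ^m u(τ) ξ_M(τ,u) ξ_{n::N}(τ,u) dτ
  + ∫_0^θ τ^n u(τ) ξ_{m::M}(τ,u) ξ_N(τ,u) dτ`. -/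
theorem xi_mul_recursion (θ : ℝ) (hθ : 0 ≤ θ) (u : ℝ → ℝ) (hu : Measurable u)
    (hbd : ∃ C : ℝ, ∀ᵐ t ∂(volume.restrict (Set.Icc (0:ℝ) θ)), |u t| ≤ C)
    (m n : ℕ) (M N : List ℕ) :
    xi (m :: M) θ u * xi (n :: N) θ u =
      (∫ τ in (0:ℝ)..θ, τ ^ m * u τ * (xi M τ u * xi (n :: N) τ u)) +
      ∫ τ in (0:ℝ)..θ, τ ^ n * u τ * (xi (m :: M) τ u * xi N τ u) := by
  obtain ⟨C, hC⟩ := hbd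
  have hint : IntervalIntegrable u volume 0 θ := by
    rw [intervalIntegrable_iff_integrableOn_Icc_of_le hθ]
    exact Measure.integrableOn_of_bounded (by simp) hu.aestronglyMeasurable hC
  have h := (intervalIntegrable_pow_mul_mul_xi hint m M).integral_mul_integral
    (intervalIntegrable_pow_mul_mul_xi hint n N)
  simp only [xi]
  rw [h]
  congr 1 <;> refine intervalIntegral.integral_congr fun τ _ ↦ ?_ <;> ring
end

section
/- Let V be a real vector space which is the internal direct sum of a family of submodules L^1, L^2, L^3, … indexed by the positive integers, and let v : V → ℝ^n be a surjective linear map. For each m ≥ 1 define the submodule P^m = { ℓ ∈ L^m : v(ℓ) ∈ v(L^1 + ⋯ + L^{m−1}) } (with P^1 = { ℓ ∈ L^1 : v(ℓ) = 0 }), and let L_v = Σ_{m≥1} P^m. Then the quotient space V / L_v is finite-dimensional of dimension exactly n. -/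
open DirectSum in
/-- If `x` lies in the sum of submodules `P i` of the pieces of a grading, then every homogeneous
component of `x` lies in the corresponding `P i`. -/
theorem coe_decompose_mem_of_mem_iSup {ι R M : Type*} [DecidableEq ι] [Ring R] [AddCommGroup M]
    [Module R M] (L : ι → Submodule R M) [Decomposition L] {P : ι → Submodule R M}
    (hP : ∀ i, P i ≤ L i) {x : M} (hx : x ∈ ⨆ i, P i) (k : ι) :
    (decompose L x k : M) ∈ P k := by
  induction hx using Submodule.iSup_induction' with
  | mem i x hx =>
    by_cases h : i = k
    · subst h
      rwa [decompose_of_mem_same L (hP i hx)]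
    · rw [decompose_of_mem_ne L (hP i hx) h]
      exact zero_mem _
  | zero => simp
  | add x y _ _ hx hy => simpa [decompose_add] using add_mem hx hy

/-- Each submodule contained in another one has a complement relative to it. -/
theorem Submodule.exists_relative_compl {K M : Type*} [DivisionRing K] [AddCommGroup M]
    [Module K M] {A B : Submodule K M} (h : A ≤ B) :
    ∃ Q : Submodule K M, Q ≤ B ∧ Disjoint A Q ∧ A ⊔ Q = B := by
  obtain ⟨C, hC⟩ := A.exists_isCompl
  refine ⟨C ⊓ B, inf_le_right, hC.disjoint.mono_right inf_le_left, ?_⟩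
  rw [← sup_inf_assoc_of_le C h, hC.sup_eq_top, top_inf_eq]


/-- Abstract codimension property of the core Lie subalgebra: if a real vector
space `V` is the internal direct sum of submodules `L^1, L^2, …` indexed by the
positive integers and `v : V → ℝ^n` is a surjective linear map, then for
`P^m = { ℓ ∈ L^m : v ℓ ∈ v(L^1 + ⋯ + L^{m-1}) }` and `L_v = Σ_m P^m`, the
quotient `V / L_v` is finite-dimensional of dimension exactly `n`. -/
theorem core_subalgebra_codim (n : ℕ) (V : Type*) [AddCommGroup V] [Module ℝ V]
    (L : ℕ+ → Submodule ℝ V) (hL : DirectSum.IsInternal L)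
    (v : V →ₗ[ℝ] (Fin n → ℝ)) (hv : Function.Surjective v)
    (P : ℕ+ → Submodule ℝ V)
    (hP : ∀ m : ℕ+, P m =
      L m ⊓ Submodule.comap v (Submodule.map v (⨆ k : ℕ+, ⨆ _ : k < m, L k)))
    (Lv : Submodule ℝ V) (hLv : Lv = ⨆ m : ℕ+, P m) :
    FiniteDimensional ℝ (V ⧸ Lv) ∧ Module.finrank ℝ (V ⧸ Lv) = n := by
  classical
  have hPL : ∀ m, P m ≤ L m := fun m => (hP m).le.trans inf_le_left
  choose Q hQL hdisj hsup using fun m => Submodule.exists_relative_compl (hPL m)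
  let := hL.chooseDecomposition
  have hcompl : IsCompl Lv (⨆ m, Q m) := by
    constructor
    · rw [Submodule.disjoint_def]
      intro x hxP hxQ
      rw [hLv] at hxP
      rw [← DirectSum.sum_support_decompose L x]
      exact Finset.sum_eq_zero fun k _ => Submodule.disjoint_def.1 (hdisj k) _
        (coe_decompose_mem_of_mem_iSup L hPL hxP k) (coe_decompose_mem_of_mem_iSup L hQL hxQ k)
    · rw [codisjoint_iff, hLv, ← iSup_sup_eq]
      simp_rw [hsup]
      exact hL.submodule_iSup_eq_top
  have hmap : ∀ m, (L m).map v ≤ (⨆ k, Q k).map v := by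
    intro m
    induction m using WellFoundedLT.induction with
    | ind m ih =>
      rw [← hsup m, Submodule.map_sup]
      refine sup_le ?_ (Submodule.map_mono (le_iSup Q m))
      rw [Submodule.map_le_iff_le_comap]
      refine ((hP m).le.trans inf_le_right).trans (Submodule.comap_mono ?_)
      simp_rw [Submodule.map_iSup] at ih ⊢
      exact iSup₂_le ih
  have hbij : Function.Bijective (v.domRestrict (⨆ m, Q m)) := by
    constructor
    · rw [← LinearMap.ker_eq_bot, LinearMap.ker_eq_bot']
      rintro ⟨x, hxQ⟩ hx
      rw [LinearMap.domRestrict_apply] at hx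
      by_contra hne
      have hne' : (DirectSum.decompose L x).support.Nonempty := by
        rw [Finset.nonempty_iff_ne_empty, Ne, DFinsupp.support_eq_empty]
        intro h
        exact hne (Subtype.ext
          ((DirectSum.decompose L).injective (h.trans (DirectSum.decompose_zero L).symm)))
      set m := (DirectSum.decompose L x).support.max' hne'
      have hmem : m ∈ (DirectSum.decompose L x).support := Finset.max'_mem _ _
      have hsum := DirectSum.sum_support_decompose L x
      rw [← Finset.add_sum_erase _ _ hmem] at hsum
      have hxm : (DirectSum.decompose L x m : V) ∈ P m := by
        rw [hP m]
        refine ⟨SetLike.coe_mem _, ?_⟩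
        refine ⟨-∑ k ∈ (DirectSum.decompose L x).support.erase m,
          (DirectSum.decompose L x k : V), neg_mem (sum_mem fun k hk => ?_), ?_⟩
        · have hkm : k < m := lt_of_le_of_ne
            (Finset.le_max' _ _ (Finset.mem_of_mem_erase hk)) (Finset.ne_of_mem_erase hk)
          exact Submodule.mem_iSup_of_mem k (Submodule.mem_iSup_of_mem hkm (SetLike.coe_mem _))
        · rw [map_neg, neg_eq_iff_add_eq_zero, add_comm, ← map_add, hsum, hx]
      have hzero := Submodule.disjoint_def.1 (hdisj m) _ hxm
        (coe_decompose_mem_of_mem_iSup L hQL hxQ m)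
      exact DFinsupp.mem_support_iff.1 hmem (Subtype.ext hzero)
    · rw [← LinearMap.range_eq_top, LinearMap.range_domRestrict, eq_top_iff,
        ← LinearMap.range_eq_top.2 hv, LinearMap.range_eq_map, ← hL.submodule_iSup_eq_top,
        Submodule.map_iSup]
      exact iSup_le hmap
  let e : (V ⧸ Lv) ≃ₗ[ℝ] (Fin n → ℝ) :=
    (Submodule.quotientEquivOfIsCompl Lv _ hcompl).trans (LinearEquiv.ofBijective _ hbij)
  exact ⟨e.symm.finiteDimensional, by rw [e.finrank_eq, Module.finrank_fin_fun]⟩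
end

section
/- Let g be a Lie algebra over ℝ and S ⊆ g a subset. Then the Lie subalgebra of g generated by S coincides, as a subspace, with the linear span of the set of all right normed brackets [s_1,[s_2,[…,[s_{k−1},s_k]…]]] with k ≥ 1 and s_1,…,s_k ∈ S. -/
/-- The right normed bracket of a list of elements of a Lie algebra:
`rightNorm [x_1, …, x_k] = ⁅x_1, ⁅x_2, ⁅…, ⁅x_{k-1}, x_k⁆…⁆⁆⁆`
(and `0` for the empty list). -/
noncomputable def rightNorm {g : Type*} [LieRing g] : List g → g
  | [] => 0
  | [x] => x
  | x :: l => ⁅x, rightNorm l⁆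

/-- The linear span of the right normed brackets on `S`. -/
def rightNormSpan {g : Type*} [LieRing g] [LieAlgebra ℝ g] (S : Set g) : Submodule ℝ g :=
  Submodule.span ℝ {y : g | ∃ l : List g, l ≠ [] ∧ (∀ x ∈ l, x ∈ S) ∧ rightNorm l = y}

theorem rightNorm_cons {g : Type*} [LieRing g] (x : g) {l : List g} (hl : l ≠ []) :
    rightNorm (x :: l) = ⁅x, rightNorm l⁆ := by
  cases l with
  | nil => exact absurd rfl hl
  | cons y l => rfl

theorem rightNorm_mem {g : Type*} [LieRing g] [LieAlgebra ℝ g] {S : Set g}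
    (K : LieSubalgebra ℝ g) (hS : S ⊆ K) {l : List g} (h : ∀ x ∈ l, x ∈ S) :
    rightNorm l ∈ K := by
  induction l with
  | nil => exact K.zero_mem
  | cons x l ih =>
    rw [List.forall_mem_cons] at h
    by_cases hl : l = []
    · subst hl
      exact hS h.1
    · rw [rightNorm_cons x hl]
      exact K.lie_mem (hS h.1) (ih h.2)

theorem lie_mem_rightNormSpan_of_mem {g : Type*} [LieRing g] [LieAlgebra ℝ g] {S : Set g}
    {s y : g} (hs : s ∈ S) (hy : y ∈ rightNormSpan S) : ⁅s, y⁆ ∈ rightNormSpan S := by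
  induction hy using Submodule.span_induction with
  | mem y hy =>
    obtain ⟨l, hl, h, rfl⟩ := hy
    exact Submodule.subset_span
      ⟨s :: l, List.cons_ne_nil s l, List.forall_mem_cons.2 ⟨hs, h⟩, rightNorm_cons s hl⟩
  | zero => simp
  | add a b _ _ ha hb => rw [lie_add]; exact add_mem ha hb
  | smul c a _ ha => rw [lie_smul]; exact Submodule.smul_mem _ c ha

theorem rightNorm_lie_mem_rightNormSpan {g : Type*} [LieRing g] [LieAlgebra ℝ g] {S : Set g}
    {l : List g} (h : ∀ x ∈ l, x ∈ S) {y : g} (hy : y ∈ rightNormSpan S) :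
    ⁅rightNorm l, y⁆ ∈ rightNormSpan S := by
  induction l generalizing y with
  | nil => simp [rightNorm]
  | cons x l ih =>
    rw [List.forall_mem_cons] at h
    by_cases hl : l = []
    · subst hl
      exact lie_mem_rightNormSpan_of_mem h.1 hy
    · rw [rightNorm_cons x hl, lie_lie]
      exact sub_mem (lie_mem_rightNormSpan_of_mem h.1 (ih h.2 hy))
        (ih h.2 (lie_mem_rightNormSpan_of_mem h.1 hy))

theorem lie_mem_rightNormSpan {g : Type*} [LieRing g] [LieAlgebra ℝ g] {S : Set g}
    {x y : g} (hx : x ∈ rightNormSpan S) (hy : y ∈ rightNormSpan S) :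
    ⁅x, y⁆ ∈ rightNormSpan S := by
  induction hx using Submodule.span_induction with
  | mem x hx =>
    obtain ⟨l, -, h, rfl⟩ := hx
    exact rightNorm_lie_mem_rightNormSpan h hy
  | zero => simp
  | add a b _ _ ha hb => rw [add_lie]; exact add_mem ha hb
  | smul c a _ ha => rw [smul_lie]; exact Submodule.smul_mem _ c ha

/-- The Lie subalgebra generated by a subset `S` of a real Lie algebra coincides,
as a subspace, with the linear span of all right normed brackets of elements of `S`. -/
theorem lieSpan_eq_span_rightNorm (g : Type*) [LieRing g] [LieAlgebra ℝ g] (S : Set g) :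
    (LieSubalgebra.lieSpan ℝ g S).toSubmodule =
      Submodule.span ℝ
        {y : g | ∃ l : List g, l ≠ [] ∧ (∀ x ∈ l, x ∈ S) ∧ rightNorm l = y} := by
  apply le_antisymm
  · let K : LieSubalgebra ℝ g := { rightNormSpan S with lie_mem' := lie_mem_rightNormSpan }
    have hSK : S ⊆ K := fun s hs =>
      Submodule.subset_span ⟨[s], List.cons_ne_nil s [], by simpa using hs, rfl⟩
    exact fun x hx => LieSubalgebra.lieSpan_le.2 hSK hx
  · rw [Submodule.span_le]
    rintro _ ⟨l, -, h, rfl⟩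
    exact rightNorm_mem _ LieSubalgebra.subset_lieSpan h
end
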